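/- The structure M = (ℚ, <, ℤ), where ℤ is interpreted as a unary predicate on ℚ, is almost o-minimal: every subset of ℚ that is definable with parameters in M and bounded is a finite union of points and open intervals. -/

import Mathlib

open FirstOrder FirstOrder.Language

universe u v w x

/-- A subset of a linear order is an open interval (possibly unbounded). -/
def IsOpenIntervalSet {M : Type w} [LinearOrder M] (s : Set M) : Prop :=
  (∃ a b : M, s = Set.Ioo a b) ∨ (∃ a : M, s = Set.Ioi a) ∨ (∃ b : M, s = Set.Iio b) ∨
    s = Set.univ

/-- `s` is a finite union of points and open intervals. -/
def IsFinUnionPointsIntervals {M : Type w} [LinearOrder M] (s : Set M) : Prop :=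
  ∃ (F : Finset M) (n : ℕ) (J : Fin n → Set M),
    (∀ k, IsOpenIntervalSet (J k)) ∧ s = ↑F ∪ ⋃ k, J k

/-- `M` is o-minimal: every subset of `M` definable with parameters is a finite union of
points and open intervals. -/
def IsOMinimal (L : FirstOrder.Language.{u, v}) (M : Type w) [L.Structure M]
    [LinearOrder M] : Prop :=
  ∀ s : Set M, (Set.univ : Set M).Definable₁ L s → IsFinUnionPointsIntervals s

/-- `M` is almost o-minimal: every bounded definable (with parameters) subset of `M` is a
finite union of points and open intervals. -/
def IsAlmostOMinimal (L : FirstOrder.Language.{u, v}) (M : Type w) [L.Structure M]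
    [LinearOrder M] : Prop :=
  ∀ s : Set M, (Set.univ : Set M).Definable₁ L s → BddAbove s → BddBelow s →
    IsFinUnionPointsIntervals s

/-- `M` is downward o-minimal: every definable (with parameters) subset of `M` that is
bounded above is a finite union of points and open intervals. -/
def IsDownwardOMinimal (L : FirstOrder.Language.{u, v}) (M : Type w) [L.Structure M]
    [LinearOrder M] : Prop :=
  ∀ s : Set M, (Set.univ : Set M).Definable₁ L s → BddAbove s → IsFinUnionPointsIntervals s

/-- `M` is upward o-minimal: every definable (with parameters) subset of `M` that is
bounded below is a finite union of points and open intervals. -/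
def IsUpwardOMinimal (L : FirstOrder.Language.{u, v}) (M : Type w) [L.Structure M]
    [LinearOrder M] : Prop :=
  ∀ s : Set M, (Set.univ : Set M).Definable₁ L s → BddBelow s → IsFinUnionPointsIntervals s

/-- The relation symbols of the language `{<, Z}`: a unary predicate `z` and a binary
relation `lt`. -/
inductive QZRel : ℕ → Type
  | z : QZRel 1
  | lt : QZRel 2

/-- The language with a binary relation symbol `<` and a unary predicate symbol `Z`
(and no function symbols). -/
def QZLang : FirstOrder.Language where
  Functions _ := Empty
  Relations := QZRel

/-- The structure `M = (ℚ, <, ℤ)`: the universe is `ℚ`, `lt` is the usual order and `z`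
is interpreted as the set of integers. -/
instance : QZLang.Structure ℚ where
  funMap := fun f _ => f.elim
  RelMap := fun r x =>
    match r with
    | QZRel.z => ∃ m : ℤ, (m : ℚ) = x 0
    | QZRel.lt => x 0 < x 1

/-- The map that is the identity outside `(a, b)` and inside is piecewise linear, sending `x`
to `y`. -/
def pushMap (a b x y t : ℚ) : ℚ :=
  if t ≤ a ∨ b ≤ t then t
  else if t ≤ x then a + (t - a) * ((y - a) / (x - a))
  else b - (b - t) * ((b - y) / (b - x))

theorem pushMap_rightInverse {a b x y : ℚ} (hax : a < x) (hxb : x < b) (hay : a < y)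
    (hyb : y < b) : Function.RightInverse (pushMap a b y x) (pushMap a b x y) := by
  intro t
  have h1 : 0 < x - a := sub_pos.2 hax
  have h2 : 0 < b - x := sub_pos.2 hxb
  have h3 : 0 < y - a := sub_pos.2 hay
  have h4 : 0 < b - y := sub_pos.2 hyb
  by_cases ht : t ≤ a ∨ b ≤ t
  · simp [pushMap, ht]
  have ht' := ht
  push Not at ht'
  obtain ⟨hat, htb⟩ := ht'
  by_cases hty : t ≤ y
  · have e : pushMap a b y x t = a + (t - a) * ((x - a) / (y - a)) := by
      simp only [pushMap, ht, hty, if_true, if_false]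
    have l1 : 0 < (t - a) * ((x - a) / (y - a)) := mul_pos (sub_pos.2 hat) (div_pos h1 h3)
    have l2 : (t - a) * ((x - a) / (y - a)) ≤ x - a := by
      rw [← mul_div_assoc, div_le_iff₀ h3]
      nlinarith
    rw [e, pushMap, if_neg (by push Not; constructor <;> linarith), if_pos (by linarith)]
    field_simp
    ring
  · have e : pushMap a b y x t = b - (b - t) * ((b - x) / (b - y)) := by
      simp only [pushMap, ht, hty, if_false]
    push Not at hty
    have l1 : 0 < (b - t) * ((b - x) / (b - y)) := mul_pos (sub_pos.2 htb) (div_pos h2 h4)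
    have l2 : (b - t) * ((b - x) / (b - y)) < b - x := by
      rw [← mul_div_assoc, div_lt_iff₀ h4]
      nlinarith
    rw [e, pushMap, if_neg (by push Not; constructor <;> linarith), if_neg (by linarith)]
    field_simp
    ring

theorem pushMap_strictMono {a b x y : ℚ} (hax : a < x) (hxb : x < b) (hay : a < y)
    (hyb : y < b) : StrictMono (pushMap a b x y) := by
  intro s t hst
  have p : 0 < (y - a) / (x - a) := div_pos (sub_pos.2 hay) (sub_pos.2 hax)
  have q : 0 < (b - y) / (b - x) := div_pos (sub_pos.2 hyb) (sub_pos.2 hxb)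
  have hp : (x - a) * ((y - a) / (x - a)) = y - a := mul_div_cancel₀ _ (sub_pos.2 hax).ne'
  have hq : (b - x) * ((b - y) / (b - x)) = b - y := mul_div_cancel₀ _ (sub_pos.2 hxb).ne'
  unfold pushMap
  generalize (y - a) / (x - a) = k at *
  generalize (b - y) / (b - x) = l at *
  have hk : ∀ u v : ℚ, u < v → 0 < (v - u) * k := fun u v h => mul_pos (sub_pos.2 h) p
  have hl : ∀ u v : ℚ, u < v → 0 < (v - u) * l := fun u v h => mul_pos (sub_pos.2 h) q
  have := hk a t
  have := hk s x
  have := hk s t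
  have := hl x t
  have := hl s b
  have := hl s t
  split_ifs <;> grind

/-- The order automorphism of `ℚ` with underlying map `pushMap`. -/
def pushIso {a b x y : ℚ} (hax : a < x) (hxb : x < b) (hay : a < y) (hyb : y < b) : ℚ ≃o ℚ :=
  (pushMap_strictMono hax hxb hay hyb).orderIsoOfRightInverse _ _
    (pushMap_rightInverse hax hxb hay hyb)

/-- Any point of an open interval of `ℚ` can be moved to any other by an order automorphism
fixing the complement of the interval. -/
theorem exists_orderIso_apply_eq {a b x y : ℚ} (hx : x ∈ Set.Ioo a b) (hy : y ∈ Set.Ioo a b) :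
    ∃ f : ℚ ≃o ℚ, f x = y ∧ ∀ t, t ∉ Set.Ioo a b → f t = t := by
  refine ⟨pushIso hx.1 hx.2 hy.1 hy.2, ?_, fun t ht => ?_⟩
  · change pushMap a b x y x = y
    have h1 : x - a ≠ 0 := (sub_pos.2 hx.1).ne'
    rw [pushMap, if_neg (by push Not; exact hx), if_pos le_rfl, mul_div_cancel₀ _ h1]
    ring
  · change pushMap a b x y t = t
    rw [pushMap, if_pos]
    by_contra! h
    exact ht h

/-- An order automorphism of `ℚ` fixing every integer, as an automorphism of `(ℚ, <, ℤ)`. -/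
def qzEquiv (f : ℚ ≃o ℚ) (hf : ∀ m : ℤ, f m = m) : QZLang.Equiv ℚ ℚ where
  toEquiv := f.toEquiv
  map_fun' := fun g _ => g.elim
  map_rel' := fun r v => by
    cases r with
    | z =>
      change (∃ m : ℤ, (m : ℚ) = f (v 0)) ↔ ∃ m : ℤ, (m : ℚ) = v 0
      refine exists_congr fun m => ?_
      conv_lhs => rw [← hf m]
      exact f.injective.eq_iff
    | lt => exact f.lt_iff_lt

/-- A set definable over `A` is preserved by the automorphisms fixing `A` pointwise. -/
theorem mem_of_definable₁ {L : FirstOrder.Language.{u, v}} {M : Type w} [L.Structure M]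
    {A s : Set M} (hs : A.Definable₁ L s) (f : L.Equiv M M) (hf : ∀ a ∈ A, f a = a) {x : M}
    (hx : x ∈ s) : f x ∈ s := by
  obtain ⟨φ, hφ⟩ := Set.definable_iff_exists_formula_sum.1 hs
  have key : ∀ z : M, z ∈ s ↔ φ.Realize (Sum.elim (fun a : A => (a : M)) fun _ : Fin 1 => z) :=
    fun z => Set.ext_iff.1 hφ fun _ => z
  rw [key] at hx ⊢
  rw [← StrongHomClass.realize_formula f] at hx
  convert hx using 1
  funext i
  rcases i with a | i
  · exact (hf a a.2).symm
  · rfl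

/-- A bounded set that contains each open interval between consecutive points of `F` that it
meets is a finite union of points and open intervals. -/
theorem isFinUnionPointsIntervals_of_gaps {M : Type w} [LinearOrder M] {s : Set M} (F : Finset M)
    {c d : M} (hc : c ∈ F) (hd : d ∈ F) (hcs : c ∈ lowerBounds s) (hds : d ∈ upperBounds s)
    (h : ∀ a b : M, (∀ t ∈ F, t ∉ Set.Ioo a b) → ∀ x ∈ s, x ∈ Set.Ioo a b → Set.Ioo a b ⊆ s) :
    IsFinUnionPointsIntervals s := by
  classical
  let P := (F ×ˢ F).filter fun p => Set.Ioo p.1 p.2 ⊆ s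
  refine ⟨F.filter (· ∈ s), P.card,
    fun k => Set.Ioo (P.equivFin.symm k).1.1 (P.equivFin.symm k).1.2,
    fun k => Or.inl ⟨_, _, rfl⟩, ?_⟩
  apply Set.Subset.antisymm
  · intro x hx
    by_cases hxF : x ∈ F
    · exact Or.inl (by simp [hxF, hx])
    right
    have hcx : c < x := lt_of_le_of_ne (hcs hx) fun e => hxF (e ▸ hc)
    have hxd : x < d := lt_of_le_of_ne (hds hx) fun e => hxF (e ▸ hd)
    obtain ⟨a, ha, hamax⟩ := (F.filter (· < x)).exists_maximal ⟨c, by simp [hc, hcx]⟩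
    obtain ⟨b, hb, hbmin⟩ := (F.filter (x < ·)).exists_minimal ⟨d, by simp [hd, hxd]⟩
    rw [Finset.mem_filter] at ha hb
    have hgap : ∀ t ∈ F, t ∉ Set.Ioo a b := by
      rintro t ht ⟨hat, htb⟩
      rcases lt_trichotomy t x with htx | rfl | hxt
      · exact (hamax (Finset.mem_filter.2 ⟨ht, htx⟩) hat.le).not_gt hat
      · exact hxF ht
      · exact (hbmin (Finset.mem_filter.2 ⟨ht, hxt⟩) htb.le).not_gt htb
    have hP : (a, b) ∈ P :=
      Finset.mem_filter.2 ⟨Finset.mk_mem_product ha.1 hb.1, h a b hgap x hx ⟨ha.2, hb.2⟩⟩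
    refine Set.mem_iUnion.2 ⟨P.equivFin ⟨(a, b), hP⟩, ?_⟩
    rw [Equiv.symm_apply_apply]
    exact ⟨ha.2, hb.2⟩
  · rintro x (hx | hx)
    · exact (Finset.mem_filter.1 hx).2
    · obtain ⟨k, hk⟩ := Set.mem_iUnion.1 hx
      exact (Finset.mem_filter.1 (P.equivFin.symm k).2).2 hk

/-- The structure `M = (ℚ, <, ℤ)`, with `ℤ` a unary predicate, is
almost o-minimal: every bounded subset of `ℚ` definable with parameters in `M` is a
finite union of points and open intervals. -/
theorem rat_int_structure_almost_ominimal : IsAlmostOMinimal QZLang ℚ := by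
  classical
  rintro s hs ⟨d, hd⟩ ⟨c, hc⟩
  obtain ⟨A, -, hA⟩ := Set.definable_iff_finitely_definable.1 hs
  let Z : Finset ℚ := (Finset.Icc ⌈c⌉ ⌊d⌋).image (fun m : ℤ => (m : ℚ))
  refine isFinUnionPointsIntervals_of_gaps (insert c (insert d (A ∪ Z))) (by simp) (by simp)
    hc hd fun a b hgap x hx hxab y hy => ?_
  obtain ⟨f, hfx, hf⟩ := exists_orderIso_apply_eq hxab hy
  have hca : c ≤ a := by
    by_contra! h
    exact hgap c (by simp) ⟨h, (hc hx).trans_lt hxab.2⟩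
  have hbd : b ≤ d := by
    by_contra! h
    exact hgap d (by simp) ⟨hxab.1.trans_le (hd hx), h⟩
  have hfZ : ∀ m : ℤ, f m = m := by
    refine fun m => hf m fun hm => hgap m ?_ hm
    have hmZ : (m : ℚ) ∈ Z := Finset.mem_image_of_mem _
      (Finset.mem_Icc.2 ⟨Int.ceil_le.2 (hca.trans hm.1.le), Int.le_floor.2 (hm.2.le.trans hbd)⟩)
    simp [hmZ]
  have hfA : ∀ t ∈ (A : Set ℚ), f t = t := fun t ht =>
    hf t (hgap t (by simp [Finset.mem_coe.1 ht]))
  rw [← hfx]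
  exact mem_of_definable₁ hA (qzEquiv f hfZ) hfA hx
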